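/- Fix α ∈ (0,1) and ε ∈ (0,1]. There exist constants c, C > 0 depending only on α and ε such that for all reals a, b with a² + b² = 1, all reals A > 0, and all integers N ≥ 1 with εA ≤ N ≤ A/ε, the spectral gap λ of the Metropolis chain on 𝓑_N = {−N+1,…,N}² for the probability measure π proportional to F_N(x₁,x₂) = (1 + A·|a·(x₁−1/2)/N + b·(x₂−1/2)/N|)^α satisfies c/N² ≤ λ ≤ C/N². -/

import Mathlib

open Finset

/-- The probability measure on a finite box in `ℤ²` proportional to `F`. -/
noncomputable def metroPi2 (box : Finset (ℤ × ℤ)) (F : ℤ × ℤ → ℝ) (k : ℤ × ℤ) : ℝ :=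
  F k / ∑ l ∈ box, F l

/-- Dirichlet form of the Metropolis chain for the measure proportional to `F`
based on simple random walk: sum over unordered nearest-neighbor pairs of
`(u(k)-u(l))²·(1/4)·min{π(k),π(l)}`. -/
noncomputable def metroDirichlet2 (box : Finset (ℤ × ℤ)) (F : ℤ × ℤ → ℝ)
    (u : ℤ × ℤ → ℝ) : ℝ :=
  (∑ k ∈ box,
    if (k.1 + 1, k.2) ∈ box then
      (u (k.1 + 1, k.2) - u k) ^ 2 *
        (1 / 4 * min (metroPi2 box F k) (metroPi2 box F (k.1 + 1, k.2)))
    else 0) +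
  ∑ k ∈ box,
    if (k.1, k.2 + 1) ∈ box then
      (u (k.1, k.2 + 1) - u k) ^ 2 *
        (1 / 4 * min (metroPi2 box F k) (metroPi2 box F (k.1, k.2 + 1)))
    else 0

/-- Variance with respect to the measure proportional to `F`. -/
noncomputable def metroVar2 (box : Finset (ℤ × ℤ)) (F : ℤ × ℤ → ℝ)
    (u : ℤ × ℤ → ℝ) : ℝ :=
  ∑ k ∈ box,
    (u k - ∑ l ∈ box, u l * metroPi2 box F l) ^ 2 * metroPi2 box F k

/-- Spectral gap of the Metropolis chain:
`λ = inf { ℰ(u,u)/Var_π(u) : Var_π(u) ≠ 0 }`. -/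
noncomputable def metroGap2 (box : Finset (ℤ × ℤ)) (F : ℤ × ℤ → ℝ) : ℝ :=
  sInf {r : ℝ | ∃ u : ℤ × ℤ → ℝ, metroVar2 box F u ≠ 0 ∧
    r = metroDirichlet2 box F u / metroVar2 box F u}

/-- Telescoping over an integer interval. -/
lemma sum_Ico_int_sub (u : ℤ → ℝ) {i j : ℤ} (hij : i ≤ j) :
    ∑ x ∈ Finset.Ico i j, (u (x + 1) - u x) = u j - u i := by
  induction j, hij using Int.leInduction with
  | base => simp
  | succ n hn ih =>
    have : Finset.Ico i (n + 1) = insert n (Finset.Ico i n) := by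
      ext x; simp only [Finset.mem_Ico, Finset.mem_insert]; omega
    rw [this, Finset.sum_insert (by simp), ih]
    ring

/-- Oscillation of a function on an integer interval, in terms of its weighted energy and the
sum of the inverse weights. -/
lemma sq_sub_le_resistance_mul_energy (u w : ℤ → ℝ) (hw : ∀ x, 0 < w x) {p q i j : ℤ}
    (hi : i ∈ Finset.Icc p q) (hj : j ∈ Finset.Icc p q) :
    (u i - u j) ^ 2 ≤ 2 * (∑ x ∈ Finset.Icc p q, 1 / w x) *
      ∑ x ∈ Finset.Ico p q, (u (x + 1) - u x) ^ 2 * min (w x) (w (x + 1)) := by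
  wlog hij : i ≤ j generalizing i j
  · rw [sub_sq_comm]
    exact this hj hi (by omega)
  rw [Finset.mem_Icc] at hi hj
  have hm : ∀ x, 0 < min (w x) (w (x + 1)) := fun x => lt_min (hw _) (hw _)
  have hcs := Finset.sum_sq_le_sum_mul_sum_of_sq_le_mul (Finset.Ico i j)
    (r := fun x => u (x + 1) - u x) (f := fun x => 1 / min (w x) (w (x + 1)))
    (g := fun x => (u (x + 1) - u x) ^ 2 * min (w x) (w (x + 1)))
    (fun x _ => (one_div_pos.2 (hm x)).le) (fun x _ => mul_nonneg (sq_nonneg _) (hm x).le)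
    (fun x _ => le_of_eq (by have := (hm x).ne'; field_simp))
  rw [sum_Ico_int_sub u hij, sub_sq_comm] at hcs
  refine hcs.trans (mul_le_mul ?_ ?_ ?_ ?_)
  · have h1 : ∀ x ∈ Finset.Ico i j, 1 / min (w x) (w (x + 1)) ≤ 1 / w x + 1 / w (x + 1) := by
      intro x _
      have h1 := one_div_pos.2 (hw x)
      have h2 := one_div_pos.2 (hw (x + 1))
      rcases min_choice (w x) (w (x + 1)) with h | h <;> rw [h] <;> linarith
    refine (Finset.sum_le_sum h1).trans ?_
    rw [Finset.sum_add_distrib, two_mul]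
    refine add_le_add ?_ ?_
    · refine Finset.sum_le_sum_of_subset_of_nonneg ?_ (fun x _ _ => (one_div_pos.2 (hw x)).le)
      intro x hx
      simp only [Finset.mem_Ico, Finset.mem_Icc] at hx ⊢
      omega
    · rw [← Finset.sum_image (s := Finset.Ico i j) (g := fun x => x + 1) (f := fun x => 1 / w x)
        (by intro x _ y _ h; simpa using h)]
      refine Finset.sum_le_sum_of_subset_of_nonneg ?_ (fun x _ _ => (one_div_pos.2 (hw x)).le)
      intro x hx
      simp only [Finset.mem_image, Finset.mem_Ico, Finset.mem_Icc] at hx ⊢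
      omega
  · refine Finset.sum_le_sum_of_subset_of_nonneg ?_
      (fun x _ _ => mul_nonneg (sq_nonneg _) (hm x).le)
    intro x hx
    simp only [Finset.mem_Ico] at hx ⊢
    omega
  · exact Finset.sum_nonneg fun x _ => mul_nonneg (sq_nonneg _) (hm x).le
  · exact mul_nonneg (by norm_num) (Finset.sum_nonneg fun x _ => (one_div_pos.2 (hw x)).le)

/-- A Poincaré inequality on a square in `ℤ²`, where one column of small energy
serves as a backbone connecting the rows. -/
lemma exists_sum_sq_sub_le (p q : ℤ) (F u : ℤ → ℤ → ℝ) (hF : ∀ x y, 0 < F x y) (R : ℝ)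
    (hpq : p ≤ q) (G : Finset ℤ) (hG : G ⊆ Finset.Icc p q)
    (hGcard : ((Finset.Icc p q).card : ℝ) ≤ 4 * G.card)
    (hrow : ∀ y ∈ Finset.Icc p q, ∑ x ∈ Finset.Icc p q, 1 / F x y ≤ R)
    (hcol : ∀ z ∈ G, ∑ y ∈ Finset.Icc p q, 1 / F z y ≤ R) :
    ∃ m : ℝ, ∑ y ∈ Finset.Icc p q, ∑ x ∈ Finset.Icc p q, (u x y - m) ^ 2 ≤
      16 * R * (Finset.Icc p q).card *
      ((∑ y ∈ Finset.Icc p q, ∑ x ∈ Finset.Ico p q,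
          (u (x + 1) y - u x y) ^ 2 * min (F x y) (F (x + 1) y)) +
        ∑ x ∈ Finset.Icc p q, ∑ y ∈ Finset.Ico p q,
          (u x (y + 1) - u x y) ^ 2 * min (F x y) (F x (y + 1))) := by
  set I := Finset.Icc p q with hI
  set e₁ : ℤ → ℝ := fun y => ∑ x ∈ Finset.Ico p q,
    (u (x + 1) y - u x y) ^ 2 * min (F x y) (F (x + 1) y) with he₁
  set e₂ : ℤ → ℝ := fun x => ∑ y ∈ Finset.Ico p q,
    (u x (y + 1) - u x y) ^ 2 * min (F x y) (F x (y + 1)) with he₂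
  have hpI : p ∈ I := by simp [hI, hpq]
  have he₁0 : ∀ y, 0 ≤ e₁ y := fun y => Finset.sum_nonneg fun x _ =>
    mul_nonneg (sq_nonneg _) (lt_min (hF _ _) (hF _ _)).le
  have he₂0 : ∀ y, 0 ≤ e₂ y := fun y => Finset.sum_nonneg fun x _ =>
    mul_nonneg (sq_nonneg _) (lt_min (hF _ _) (hF _ _)).le
  have hn : (0 : ℝ) < I.card := by exact_mod_cast Finset.card_pos.2 ⟨p, hpI⟩
  have hGne : G.Nonempty := by
    rw [← Finset.card_pos]
    have : (0 : ℝ) < G.card := by linarith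
    exact_mod_cast this
  have hR0 : 0 ≤ R :=
    (Finset.sum_nonneg fun x _ => (one_div_pos.2 (hF x p)).le).trans (hrow p hpI)
  obtain ⟨z, hzG, hz⟩ := Finset.exists_min_image G e₂ hGne
  have hz' : I.card * e₂ z ≤ 4 * ∑ x ∈ I, e₂ x := by
    have h1 : G.card * e₂ z ≤ ∑ x ∈ G, e₂ x := by
      simpa using Finset.card_nsmul_le_sum G e₂ (e₂ z) hz
    have h2 : ∑ x ∈ G, e₂ x ≤ ∑ x ∈ I, e₂ x :=
      Finset.sum_le_sum_of_subset_of_nonneg hG fun x _ _ => he₂0 x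
    nlinarith [mul_le_mul_of_nonneg_right hGcard (he₂0 z)]
  refine ⟨u z p, ?_⟩
  have hpt : ∀ y ∈ I, ∀ x ∈ I, (u x y - u z p) ^ 2 ≤ 4 * R * (e₁ y + e₂ z) := by
    intro y hy x hx
    have h1 := sq_sub_le_resistance_mul_energy (fun x => u x y) (fun x => F x y)
      (fun x => hF x y) hx (hG hzG)
    have h2 := sq_sub_le_resistance_mul_energy (fun y => u z y) (fun y => F z y)
      (fun y => hF z y) hy hpI
    have h3 := mul_le_mul_of_nonneg_right (hrow y hy) (he₁0 y)
    have h4 := mul_le_mul_of_nonneg_right (hcol z hzG) (he₂0 z)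
    simp only [he₁, he₂] at h3 h4 ⊢
    nlinarith [sq_nonneg (u x y - 2 * u z y + u z p)]
  have hrowsum : ∀ y ∈ I, ∑ x ∈ I, (u x y - u z p) ^ 2 ≤ I.card * (4 * R * (e₁ y + e₂ z)) := by
    intro y hy
    simpa using Finset.sum_le_card_nsmul I _ _ (hpt y hy)
  refine (Finset.sum_le_sum hrowsum).trans ?_
  rw [← Finset.mul_sum, ← Finset.mul_sum, Finset.sum_add_distrib, Finset.sum_const, nsmul_eq_mul]
  have hE₁ : 0 ≤ ∑ y ∈ I, e₁ y := Finset.sum_nonneg fun y _ => he₁0 y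
  have hnR : 0 ≤ 4 * (I.card * R) := by positivity
  calc (I.card : ℝ) * (4 * R * (∑ y ∈ I, e₁ y + I.card * e₂ z))
      = 4 * (I.card * R) * (∑ y ∈ I, e₁ y + I.card * e₂ z) := by ring
    _ ≤ 4 * (I.card * R) * (4 * (∑ y ∈ I, e₁ y + ∑ x ∈ I, e₂ x)) := by
        apply mul_le_mul_of_nonneg_left _ hnR
        linarith
    _ = _ := by ring

/-- The mean minimizes the quadratic deviation. -/
lemma metroVar2_le (box : Finset (ℤ × ℤ)) (F u : ℤ × ℤ → ℝ) (hZ : ∑ l ∈ box, F l ≠ 0) (m : ℝ) :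
    metroVar2 box F u ≤ ∑ k ∈ box, (u k - m) ^ 2 * metroPi2 box F k := by
  have h1 : ∑ k ∈ box, metroPi2 box F k = 1 := by
    simp only [metroPi2]
    rw [← Finset.sum_div, div_self hZ]
  unfold metroVar2
  set M := ∑ l ∈ box, u l * metroPi2 box F l with hM
  have h2 : ∑ k ∈ box, (u k - m) ^ 2 * metroPi2 box F k -
      ∑ k ∈ box, (u k - M) ^ 2 * metroPi2 box F k = (M - m) ^ 2 := by
    rw [← Finset.sum_sub_distrib]
    calc _ = ∑ k ∈ box, (2 * (M - m) * (u k * metroPi2 box F k) +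
          (m ^ 2 - M ^ 2) * metroPi2 box F k) := Finset.sum_congr rfl fun k _ => by ring
      _ = (M - m) ^ 2 := by
        rw [Finset.sum_add_distrib, ← Finset.mul_sum, ← Finset.mul_sum, h1, ← hM]; ring
  linarith [sq_nonneg (M - m)]

/-- The Dirichlet form on a square as a sum of energies of rows and columns. -/
lemma metroDirichlet2_square (p q : ℤ) (F u : ℤ × ℤ → ℝ)
    (hZ : 0 < ∑ l ∈ Finset.Icc p q ×ˢ Finset.Icc p q, F l) :
    metroDirichlet2 (Finset.Icc p q ×ˢ Finset.Icc p q) F u =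
      ((∑ y ∈ Finset.Icc p q, ∑ x ∈ Finset.Ico p q,
          (u (x + 1, y) - u (x, y)) ^ 2 * min (F (x, y)) (F (x + 1, y))) +
        ∑ x ∈ Finset.Icc p q, ∑ y ∈ Finset.Ico p q,
          (u (x, y + 1) - u (x, y)) ^ 2 * min (F (x, y)) (F (x, y + 1))) /
      (4 * ∑ l ∈ Finset.Icc p q ×ˢ Finset.Icc p q, F l) := by
  have hfil : ∀ (f : ℤ → ℝ), (∑ x ∈ Finset.Icc p q, if x + 1 ∈ Finset.Icc p q then f x else 0) =
      ∑ x ∈ Finset.Ico p q, f x := by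
    intro f
    rw [← Finset.sum_filter]
    congr 1
    ext x
    simp only [Finset.mem_filter, Finset.mem_Icc, Finset.mem_Ico]
    omega
  unfold metroDirichlet2
  simp only [metroPi2, min_div_div_right hZ.le]
  generalize (∑ l ∈ Finset.Icc p q ×ˢ Finset.Icc p q, F l) = Z at *
  rw [add_div]
  congr 1
  · rw [Finset.sum_product_right, Finset.sum_div]
    refine Finset.sum_congr rfl fun y hy => ?_
    simp only [Finset.mem_product, hy, and_true]
    rw [hfil, Finset.sum_div]
    exact Finset.sum_congr rfl fun x _ => by field_simp
  · rw [Finset.sum_product, Finset.sum_div]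
    refine Finset.sum_congr rfl fun x hx => ?_
    simp only [Finset.mem_product, hx, true_and]
    rw [hfil, Finset.sum_div]
    exact Finset.sum_congr rfl fun y _ => by field_simp

/-- Lower bound for the spectral gap on a square by resistances of rows and of many columns. -/
lemma metroVar2_le_mul_metroDirichlet2 (p q : ℤ) (F u : ℤ × ℤ → ℝ) (hF : ∀ k, 0 < F k) (R B : ℝ)
    (hpq : p ≤ q) (G : Finset ℤ) (hG : G ⊆ Finset.Icc p q)
    (hGcard : ((Finset.Icc p q).card : ℝ) ≤ 4 * G.card)
    (hB : ∀ k ∈ Finset.Icc p q ×ˢ Finset.Icc p q, F k ≤ B)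
    (hrow : ∀ y ∈ Finset.Icc p q, ∑ x ∈ Finset.Icc p q, 1 / F (x, y) ≤ R)
    (hcol : ∀ z ∈ G, ∑ y ∈ Finset.Icc p q, 1 / F (z, y) ≤ R) :
    metroVar2 (Finset.Icc p q ×ˢ Finset.Icc p q) F u ≤
      64 * B * R * (Finset.Icc p q).card *
        metroDirichlet2 (Finset.Icc p q ×ˢ Finset.Icc p q) F u := by
  have hp : p ∈ Finset.Icc p q := Finset.left_mem_Icc.2 hpq
  have hZ : 0 < ∑ l ∈ Finset.Icc p q ×ˢ Finset.Icc p q, F l :=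
    Finset.sum_pos (fun k _ => hF k) ⟨(p, p), Finset.mk_mem_product hp hp⟩
  have hB0 : 0 ≤ B := (hF _).le.trans (hB (p, p) (Finset.mk_mem_product hp hp))
  obtain ⟨m, hm⟩ := exists_sum_sq_sub_le p q (fun x y => F (x, y)) (fun x y => u (x, y))
    (fun x y => hF _) R hpq G hG hGcard hrow hcol
  refine (metroVar2_le _ F u hZ.ne' m).trans ?_
  rw [metroDirichlet2_square p q F u hZ]
  simp only [metroPi2]
  have h1 : ∑ k ∈ Finset.Icc p q ×ˢ Finset.Icc p q,
      (u k - m) ^ 2 * (F k / ∑ l ∈ Finset.Icc p q ×ˢ Finset.Icc p q, F l) ≤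
      B * (∑ y ∈ Finset.Icc p q, ∑ x ∈ Finset.Icc p q, (u (x, y) - m) ^ 2) /
        ∑ l ∈ Finset.Icc p q ×ˢ Finset.Icc p q, F l := by
    rw [← Finset.sum_product_right (s := Finset.Icc p q) (t := Finset.Icc p q)
      (f := fun k => (u k - m) ^ 2), Finset.mul_sum, Finset.sum_div]
    refine Finset.sum_le_sum fun k hk => ?_
    rw [← mul_div_assoc, mul_comm]
    gcongr
    exact hB k hk
  refine h1.trans ?_
  rw [mul_div_assoc']
  rw [div_le_div_iff₀ hZ (by positivity)]
  have h2 := mul_le_mul_of_nonneg_left hm hB0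
  nlinarith [mul_le_mul_of_nonneg_right h2 hZ.le]

/-- The sum of absolute deviations over a symmetric box. -/
lemma sq_le_sum_abs_sub (N : ℕ) (m : ℝ) :
    (N : ℝ) ^ 2 ≤ ∑ x ∈ Finset.Icc (-(N : ℤ) + 1) N, |(x : ℝ) - m| := by
  induction N with
  | zero => simp
  | succ n ih =>
    have : Finset.Icc (-((n + 1 : ℕ) : ℤ) + 1) ((n + 1 : ℕ) : ℤ) =
        insert (-(n : ℤ)) (insert ((n : ℤ) + 1) (Finset.Icc (-(n : ℤ) + 1) n)) := by
      ext x
      simp only [Finset.mem_insert, Finset.mem_Icc]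
      push_cast
      omega
    rw [this, Finset.sum_insert, Finset.sum_insert]
    · push_cast
      have h1 := le_abs_self ((n : ℝ) + 1 - m)
      have h2 := neg_abs_le (-(n : ℝ) - m)
      linarith
    · simp
    · simp only [Finset.mem_insert, Finset.mem_Icc]
      omega

/-- Lower bound for the variance of the first coordinate by resistances of rows. -/
lemma le_metroVar2_fst (N : ℕ) (hN : 1 ≤ N) (F : ℤ × ℤ → ℝ) (hF : ∀ k, 0 < F k) (R B : ℝ)
    (hB : ∀ k ∈ Finset.Icc (-(N : ℤ) + 1) N ×ˢ Finset.Icc (-(N : ℤ) + 1) N, F k ≤ B)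
    (hrow : ∀ y ∈ Finset.Icc (-(N : ℤ) + 1) N,
      ∑ x ∈ Finset.Icc (-(N : ℤ) + 1) N, 1 / F (x, y) ≤ R) :
    (N : ℝ) ^ 3 ≤ 2 * R * B * metroVar2 (Finset.Icc (-(N : ℤ) + 1) N ×ˢ
      Finset.Icc (-(N : ℤ) + 1) N) F (fun k => (k.1 : ℝ)) := by
  set I := Finset.Icc (-(N : ℤ) + 1) N with hI
  have hN0 : (0 : ℝ) < N := by exact_mod_cast hN
  have hNI : (N : ℤ) ∈ I := by simp [hI]; omega
  have hcard : (I.card : ℝ) = 2 * N := by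
    have : I.card = 2 * N := by simp [hI]; omega
    rw [this]; push_cast; ring
  have hZ : 0 < ∑ l ∈ I ×ˢ I, F l :=
    Finset.sum_pos (fun k _ => hF k) ⟨((N : ℤ), (N : ℤ)), Finset.mk_mem_product hNI hNI⟩
  have hR0 : 0 < R :=
    (Finset.sum_pos (fun x _ => one_div_pos.2 (hF (x, N))) ⟨_, hNI⟩).trans_le (hrow N hNI)
  have hZB : ∑ l ∈ I ×ˢ I, F l ≤ 4 * N ^ 2 * B := by
    have h := Finset.sum_le_card_nsmul (I ×ˢ I) F B hB
    rw [Finset.card_product, nsmul_eq_mul] at h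
    push_cast at h
    rw [hcard] at h
    linarith
  unfold metroVar2
  simp only [metroPi2]
  generalize (∑ l ∈ I ×ˢ I, (l.1 : ℝ) * (F l / ∑ l ∈ I ×ˢ I, F l)) = m
  simp only [← mul_div_assoc]
  rw [← Finset.sum_div]
  generalize (∑ l ∈ I ×ˢ I, F l) = Z at *
  rw [Finset.sum_product_right]
  have hy : ∀ y ∈ I, (N : ℝ) ^ 4 / R ≤ ∑ x ∈ I, ((x : ℝ) - m) ^ 2 * F (x, y) := by
    intro y hy
    have hcs := Finset.sum_sq_le_sum_mul_sum_of_sq_le_mul I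
      (r := fun x : ℤ => |(x : ℝ) - m|) (f := fun x => 1 / F (x, y))
      (g := fun x => ((x : ℝ) - m) ^ 2 * F (x, y))
      (fun x _ => (one_div_pos.2 (hF _)).le) (fun x _ => mul_nonneg (sq_nonneg _) (hF _).le)
      (fun x _ => le_of_eq (by have := (hF (x, y)).ne'; rw [sq_abs]; field_simp))
    have h0 := pow_le_pow_left₀ (by positivity) (sq_le_sum_abs_sub N m) 2
    rw [div_le_iff₀ hR0]
    have hS : 0 ≤ ∑ x ∈ I, ((x : ℝ) - m) ^ 2 * F (x, y) :=
      Finset.sum_nonneg fun x _ => mul_nonneg (sq_nonneg _) (hF _).le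
    calc (N : ℝ) ^ 4 = ((N : ℝ) ^ 2) ^ 2 := by ring
      _ ≤ _ := h0
      _ ≤ _ := hcs
      _ ≤ _ := by
        rw [mul_comm]
        exact mul_le_mul_of_nonneg_left (hrow y hy) hS
  have hsum := Finset.card_nsmul_le_sum I _ _ hy
  rw [nsmul_eq_mul, hcard] at hsum
  generalize (∑ y ∈ I, ∑ x ∈ I, ((x : ℝ) - m) ^ 2 * F (x, y)) = V at *
  rw [mul_div_assoc', div_le_iff₀ hR0] at hsum
  rw [mul_div_assoc', le_div_iff₀ hZ]
  have hB0 : 0 < B := (hF _).trans_le (hB (N, N) (Finset.mk_mem_product hNI hNI))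
  calc (N : ℝ) ^ 3 * Z ≤ N ^ 3 * (4 * N ^ 2 * B) := by gcongr
    _ = 2 * B * (2 * N * N ^ 4) := by ring
    _ ≤ 2 * B * (V * R) := by gcongr
    _ = _ := by ring

/-- The energy of the first coordinate. -/
lemma metroDirichlet2_fst_le (box : Finset (ℤ × ℤ)) (F : ℤ × ℤ → ℝ) (hF : ∀ k, 0 < F k) :
    metroDirichlet2 box F (fun k => (k.1 : ℝ)) ≤ 1 / 4 := by
  have hZ : 0 ≤ ∑ l ∈ box, F l := Finset.sum_nonneg fun k _ => (hF k).le
  have h0 : ∀ k, 0 ≤ metroPi2 box F k := fun k => div_nonneg (hF k).le hZ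
  have h1 : ∑ k ∈ box, metroPi2 box F k ≤ 1 := by
    simp only [metroPi2]
    rw [← Finset.sum_div]
    exact div_self_le_one _
  unfold metroDirichlet2
  have h2 : ∀ k ∈ box, (if (k.1 + 1, k.2) ∈ box then
      (((k.1 + 1 : ℤ) : ℝ) - (k.1 : ℝ)) ^ 2 *
        (1 / 4 * min (metroPi2 box F k) (metroPi2 box F (k.1 + 1, k.2))) else 0) ≤
      1 / 4 * metroPi2 box F k := by
    intro k _
    split_ifs
    · push_cast
      have := min_le_left (metroPi2 box F k) (metroPi2 box F (k.1 + 1, k.2))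
      ring_nf at this ⊢
      linarith
    · linarith [h0 k]
  have h3 := Finset.sum_le_sum h2
  rw [← Finset.mul_sum] at h3
  simp only [sub_self, ne_eq, OfNat.ofNat_ne_zero, not_false_eq_true, zero_pow, zero_mul,
    ite_self, Finset.sum_const_zero, add_zero]
  linarith

lemma metroDirichlet2_nonneg (box : Finset (ℤ × ℤ)) (F u : ℤ × ℤ → ℝ) (hF : ∀ k, 0 < F k) :
    0 ≤ metroDirichlet2 box F u := by
  have hZ : 0 ≤ ∑ l ∈ box, F l := Finset.sum_nonneg fun k _ => (hF k).le
  have h0 : ∀ k, 0 ≤ metroPi2 box F k := fun k => div_nonneg (hF k).le hZ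
  unfold metroDirichlet2
  refine add_nonneg ?_ ?_ <;>
  · refine Finset.sum_nonneg fun k _ => ?_
    split_ifs
    · exact mul_nonneg (sq_nonneg _) (mul_nonneg (by norm_num) (le_min (h0 _) (h0 _)))
    · exact le_rfl

lemma metroVar2_nonneg (box : Finset (ℤ × ℤ)) (F u : ℤ × ℤ → ℝ) (hF : ∀ k, 0 < F k) :
    0 ≤ metroVar2 box F u :=
  Finset.sum_nonneg fun k _ => mul_nonneg (sq_nonneg _)
    (div_nonneg (hF k).le (Finset.sum_nonneg fun k _ => (hF k).le))

/-- Two-sided bound for the spectral gap on a square when the rows, and at least a quarter of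
the columns, have small resistance. -/
lemma metroGap2_bounds (N : ℕ) (hN : 1 ≤ N) (F : ℤ × ℤ → ℝ) (hF : ∀ k, 0 < F k) (R B : ℝ)
    (G : Finset ℤ) (hG : G ⊆ Finset.Icc (-(N : ℤ) + 1) N) (hGcard : (N : ℝ) ≤ 2 * G.card)
    (hB : ∀ k ∈ Finset.Icc (-(N : ℤ) + 1) N ×ˢ Finset.Icc (-(N : ℤ) + 1) N, F k ≤ B)
    (hrow : ∀ y ∈ Finset.Icc (-(N : ℤ) + 1) N,
      ∑ x ∈ Finset.Icc (-(N : ℤ) + 1) N, 1 / F (x, y) ≤ R)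
    (hcol : ∀ z ∈ G, ∑ y ∈ Finset.Icc (-(N : ℤ) + 1) N, 1 / F (z, y) ≤ R) :
    1 / (128 * B * R * N) ≤
        metroGap2 (Finset.Icc (-(N : ℤ) + 1) N ×ˢ Finset.Icc (-(N : ℤ) + 1) N) F ∧
      metroGap2 (Finset.Icc (-(N : ℤ) + 1) N ×ˢ Finset.Icc (-(N : ℤ) + 1) N) F ≤
        B * R / N ^ 3 := by
  set I := Finset.Icc (-(N : ℤ) + 1) N with hI
  have hN0 : (0 : ℝ) < N := by exact_mod_cast hN
  have hNI : (N : ℤ) ∈ I := by simp [hI]; omega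
  have hcard : (I.card : ℝ) = 2 * N := by
    have : I.card = 2 * N := by simp [hI]; omega
    rw [this]; push_cast; ring
  have hB0 : 0 < B := (hF _).trans_le (hB (N, N) (Finset.mk_mem_product hNI hNI))
  have hR0 : 0 < R :=
    (Finset.sum_pos (fun x _ => one_div_pos.2 (hF (x, N))) ⟨_, hNI⟩).trans_le (hrow N hNI)
  have hvar := le_metroVar2_fst N hN F hF R B hB hrow
  have hvar0 : 0 < metroVar2 (I ×ˢ I) F (fun k => (k.1 : ℝ)) := by
    have : 0 < 2 * R * B * metroVar2 (I ×ˢ I) F (fun k => (k.1 : ℝ)) :=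
      lt_of_lt_of_le (by positivity) hvar
    exact pos_of_mul_pos_right this (by positivity)
  constructor
  · refine le_csInf ⟨_, _, hvar0.ne', rfl⟩ ?_
    rintro r ⟨u, hu, rfl⟩
    have hu0 := lt_of_le_of_ne (metroVar2_nonneg (I ×ˢ I) F u hF) hu.symm
    rw [div_le_div_iff₀ (by positivity) hu0]
    have h := metroVar2_le_mul_metroDirichlet2 (-(N : ℤ) + 1) N F u hF R B (by omega) G hG
      (by rw [hcard]; linarith) hB hrow hcol
    rw [← hI, hcard] at h
    linarith
  · refine le_trans (csInf_le (a := metroDirichlet2 (I ×ˢ I) F (fun k => (k.1 : ℝ)) /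
      metroVar2 (I ×ˢ I) F (fun k => (k.1 : ℝ))) ⟨0, ?_⟩ ⟨_, hvar0.ne', rfl⟩) ?_
    · rintro r ⟨u, -, rfl⟩
      exact div_nonneg (metroDirichlet2_nonneg _ F u hF) (metroVar2_nonneg _ F u hF)
    · rw [div_le_div_iff₀ hvar0 (by positivity)]
      have h := metroDirichlet2_fst_le (I ×ˢ I) F hF
      have hp : (0 : ℝ) < N ^ 3 := by positivity
      have hBRV : 0 < B * R * metroVar2 (I ×ˢ I) F (fun k => (k.1 : ℝ)) := by positivity
      nlinarith [mul_le_mul_of_nonneg_right h hp.le]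

/-- Exchanging the coordinates does not change the spectral gap. -/
lemma metroGap2_swap (I : Finset ℤ) (F : ℤ × ℤ → ℝ) :
    metroGap2 (I ×ˢ I) (fun k => F k.swap) = metroGap2 (I ×ˢ I) F := by
  have hsum : ∀ f : ℤ × ℤ → ℝ, ∑ k ∈ I ×ˢ I, f k.swap = ∑ k ∈ I ×ˢ I, f k := by
    intro f
    rw [Finset.sum_product, Finset.sum_product_right]
    rfl
  have hpi : ∀ (F : ℤ × ℤ → ℝ) k,
      metroPi2 (I ×ˢ I) (fun k => F k.swap) k = metroPi2 (I ×ˢ I) F k.swap := by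
    intro F k
    simp only [metroPi2]
    rw [hsum F]
  have hvar : ∀ F u : ℤ × ℤ → ℝ, metroVar2 (I ×ˢ I) (fun k => F k.swap) (fun k => u k.swap) =
      metroVar2 (I ×ˢ I) F u := by
    intro F u
    simp only [metroVar2, hpi]
    rw [hsum fun l => u l * metroPi2 (I ×ˢ I) F l]
    exact hsum fun k => (u k - ∑ l ∈ I ×ˢ I, u l * metroPi2 (I ×ˢ I) F l) ^ 2 *
      metroPi2 (I ×ˢ I) F k
  have hdir : ∀ F u : ℤ × ℤ → ℝ,
      metroDirichlet2 (I ×ˢ I) (fun k => F k.swap) (fun k => u k.swap) =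
      metroDirichlet2 (I ×ˢ I) F u := by
    intro F u
    simp only [metroDirichlet2, hpi]
    rw [add_comm]
    congr 1
    · rw [← hsum]
      refine Finset.sum_congr rfl fun k _ => ?_
      simp [Finset.mem_product, and_comm]
    · rw [← hsum]
      refine Finset.sum_congr rfl fun k _ => ?_
      simp [Finset.mem_product, and_comm]
  unfold metroGap2
  congr 1
  ext r
  constructor
  · rintro ⟨u, hu, rfl⟩
    refine ⟨fun k => u k.swap, ?_, ?_⟩
    · rw [← hvar]; simpa using hu
    · rw [← hvar, ← hdir]; simp
  · rintro ⟨u, hu, rfl⟩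
    exact ⟨fun k => u k.swap, by rwa [hvar], by rw [hvar, hdir]⟩

/-- Power sums with exponent in `(-1, 0)`. -/
lemma sum_range_rpow_neg_le {α : ℝ} (hα0 : 0 < α) (hα1 : α < 1) (n : ℕ) :
    ∑ m ∈ Finset.range n, ((m : ℝ) + 1) ^ (-α) ≤ (n : ℝ) ^ (1 - α) / (1 - α) := by
  have h1 : 0 < 1 - α := by linarith
  induction n with
  | zero => simp [Real.zero_rpow h1.ne']
  | succ n ih =>
    rw [Finset.sum_range_succ]
    have hx : (0 : ℝ) < (n : ℝ) + 1 := by positivity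
    -- Bernoulli inequality for exponents in `(0, 1)`
    have hb : (n : ℝ) ^ (1 - α) ≤ ((n : ℝ) + 1) ^ (1 - α) - (1 - α) * ((n : ℝ) + 1) ^ (-α) := by
      have h := rpow_one_add_le_one_add_mul_self (s := -1 / ((n : ℝ) + 1)) (p := 1 - α)
        (by rw [le_div_iff₀ hx]; linarith [(Nat.cast_nonneg n : (0 : ℝ) ≤ n)]) h1.le (by linarith)
      have h2 := mul_le_mul_of_nonneg_right h (Real.rpow_nonneg hx.le (1 - α))
      have h3 : 1 + -1 / ((n : ℝ) + 1) = n / ((n : ℝ) + 1) := by field_simp; ring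
      rw [h3, ← Real.mul_rpow (by positivity) hx.le, div_mul_cancel₀ _ hx.ne'] at h2
      have h4 : ((n : ℝ) + 1) ^ (-α) = ((n : ℝ) + 1) ^ (1 - α) / ((n : ℝ) + 1) := by
        rw [← Real.rpow_sub_one hx.ne']; congr 1; ring
      rw [h4]
      calc _ ≤ _ := h2
        _ = _ := by field_simp; ring
    have h5 := div_le_div_of_nonneg_right hb h1.le
    rw [sub_div, mul_div_cancel_left₀ _ h1.ne'] at h5
    push_cast
    linarith

/-- The resistance of a line crossing the valley transversally. -/
lemma sum_one_div_rpow_le {α ε : ℝ} (hα0 : 0 < α) (hα1 : α < 1) (hε0 : 0 < ε) (hε1 : ε ≤ 1)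
    (N : ℕ) (hN : 1 ≤ N) (κ r s : ℝ) (hκ : ε ≤ κ) (hr : 1 / 8 ≤ |r|) (hs : |s| ≤ N) :
    ∑ x ∈ Finset.Icc (-(N : ℤ) + 1) N, 1 / (1 + κ * |r * ((x : ℝ) - 1 / 2) + s|) ^ α ≤
      176 / (ε * (1 - α)) * (N : ℝ) ^ (1 - α) := by
  have h1 : 0 < 1 - α := by linarith
  have hN0 : (0 : ℝ) < N := by exact_mod_cast hN
  have hN1 : (1 : ℝ) ≤ N := by exact_mod_cast hN
  have hκ0 : 0 ≤ κ := hε0.le.trans hκ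
  have hr0 : r ≠ 0 := by
    rintro rfl
    norm_num at hr
  set t : ℝ := 1 / 2 - s / r with ht
  have ht_abs : |t| ≤ 1 / 2 + 8 * N := by
    have h : |s / r| ≤ 8 * N := by
      rw [abs_div, div_le_iff₀ (by linarith)]
      nlinarith
    calc |t| ≤ |(1 / 2 : ℝ)| + |s / r| := abs_sub _ _
      _ ≤ _ := by rw [abs_of_pos (by norm_num)]; linarith
  set i₀ : ℤ := round t with hi₀
  have hround : |t - i₀| ≤ 1 / 2 := abs_sub_round t
  have hterm : ∀ x ∈ Finset.Icc (-(N : ℤ) + 1) N,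
      1 / (1 + κ * |r * ((x : ℝ) - 1 / 2) + s|) ^ α ≤
        8 / ε * (((x - i₀).natAbs : ℝ) + 1) ^ (-α) := by
    intro x _
    have e1 : r * ((x : ℝ) - 1 / 2) + s = r * (x - t) := by rw [ht]; field_simp; ring
    have e2 : ((x - i₀).natAbs : ℝ) = |(x : ℝ) - i₀| := by
      rw [Nat.cast_natAbs]; push_cast; rfl
    rw [e1, e2, abs_mul]
    have h2 : |(x : ℝ) - i₀| ≤ |(x : ℝ) - t| + 1 / 2 :=
      (abs_sub_le _ t _).trans (by linarith)
    have h3 : ε / 8 * (|(x : ℝ) - i₀| + 1) ≤ 1 + κ * (|r| * |(x : ℝ) - t|) := by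
      have h4 : ε * (1 / 8 * |(x : ℝ) - t|) ≤ κ * (|r| * |(x : ℝ) - t|) := by gcongr
      nlinarith
    have h5 : (ε / 8 * (|(x : ℝ) - i₀| + 1)) ^ α ≤ (1 + κ * (|r| * |(x : ℝ) - t|)) ^ α := by
      gcongr
    have h6 : ε / 8 ≤ (ε / 8) ^ α := by
      conv_lhs => rw [← Real.rpow_one (ε / 8)]
      exact Real.rpow_le_rpow_of_exponent_ge (by positivity) (by linarith) hα1.le
    have hpos : 0 < |(x : ℝ) - i₀| + 1 := by positivity
    rw [Real.rpow_neg hpos.le]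
    calc _ ≤ 1 / (ε / 8 * (|(x : ℝ) - i₀| + 1)) ^ α := by gcongr
      _ = 1 / ((ε / 8) ^ α * (|(x : ℝ) - i₀| + 1) ^ α) := by
        rw [Real.mul_rpow (by positivity) hpos.le]
      _ ≤ 1 / ((ε / 8) * (|(x : ℝ) - i₀| + 1) ^ α) := by gcongr
      _ = _ := by field_simp
  refine (Finset.sum_le_sum hterm).trans ?_
  rw [← Finset.mul_sum]
  have hmaps : ∀ x ∈ Finset.Icc (-(N : ℤ) + 1) N, (x - i₀).natAbs ∈ Finset.range (11 * N) := by
    intro x hx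
    rw [Finset.mem_Icc] at hx
    have h7 : |(i₀ : ℝ)| ≤ 8 * N + 1 := by
      have := abs_sub_abs_le_abs_sub (i₀ : ℝ) t
      rw [abs_sub_comm (i₀ : ℝ) t] at this
      linarith
    have h8 : |i₀| ≤ 8 * N + 1 := by exact_mod_cast h7
    rw [abs_le] at h8
    rw [Finset.mem_range]
    omega
  have hfib : ∑ x ∈ Finset.Icc (-(N : ℤ) + 1) N, (((x - i₀).natAbs : ℝ) + 1) ^ (-α) ≤
      2 * ∑ m ∈ Finset.range (11 * N), ((m : ℝ) + 1) ^ (-α) := by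
    rw [← Finset.sum_fiberwise_of_maps_to hmaps, Finset.mul_sum]
    refine Finset.sum_le_sum fun m _ => ?_
    have h9 : ∀ x ∈ (Finset.Icc (-(N : ℤ) + 1) N).filter (fun x => (x - i₀).natAbs = m),
        (((x - i₀).natAbs : ℝ) + 1) ^ (-α) = ((m : ℝ) + 1) ^ (-α) := by
      intro x hx
      rw [(Finset.mem_filter.1 hx).2]
    rw [Finset.sum_congr rfl h9, Finset.sum_const, nsmul_eq_mul]
    have hcard : ((Finset.Icc (-(N : ℤ) + 1) N).filter (fun x => (x - i₀).natAbs = m)).card ≤ 2 := by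
      refine (Finset.card_le_card (t := {i₀ + m, i₀ - m}) ?_).trans Finset.card_le_two
      intro x hx
      have := (Finset.mem_filter.1 hx).2
      simp only [Finset.mem_insert, Finset.mem_singleton]
      omega
    gcongr
    exact_mod_cast hcard
  have hsum := sum_range_rpow_neg_le hα0 hα1 (11 * N)
  have h11 : ((11 * N : ℕ) : ℝ) ^ (1 - α) ≤ 11 * (N : ℝ) ^ (1 - α) := by
    push_cast
    rw [Real.mul_rpow (by norm_num) hN0.le]
    gcongr
    conv_rhs => rw [← Real.rpow_one 11]
    exact Real.rpow_le_rpow_of_exponent_le (by norm_num) (by linarith)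
  calc _ ≤ 8 / ε * (2 * (11 * (N : ℝ) ^ (1 - α) / (1 - α))) := by
        have := hfib.trans (mul_le_mul_of_nonneg_left
          (hsum.trans (div_le_div_of_nonneg_right h11 h1.le)) zero_le_two)
        gcongr
    _ = _ := by field_simp; norm_num

/-- The resistance of a line staying far from the valley. -/
lemma sum_one_div_rpow_le_of_far {α ε : ℝ} (hα0 : 0 < α) (hα1 : α < 1) (hε0 : 0 < ε)
    (hε1 : ε ≤ 1) (N : ℕ) (hN : 1 ≤ N) (d : ℤ → ℝ)
    (hd : ∀ x ∈ Finset.Icc (-(N : ℤ) + 1) N, ε * N / 8 ≤ d x) :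
    ∑ x ∈ Finset.Icc (-(N : ℤ) + 1) N, 1 / (1 + d x) ^ α ≤
      176 / (ε * (1 - α)) * (N : ℝ) ^ (1 - α) := by
  have h1 : 0 < 1 - α := by linarith
  have hN0 : (0 : ℝ) < N := by exact_mod_cast hN
  have hcard : ((Finset.Icc (-(N : ℤ) + 1) N).card : ℝ) = 2 * N := by
    have : (Finset.Icc (-(N : ℤ) + 1) N).card = 2 * N := by simp; omega
    rw [this]; push_cast; ring
  have hterm : ∀ x ∈ Finset.Icc (-(N : ℤ) + 1) N,
      1 / (1 + d x) ^ α ≤ 8 / ε * ((N : ℝ) ^ (1 - α) / N) := by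
    intro x hx
    have h6 : ε / 8 ≤ (ε / 8) ^ α := by
      conv_lhs => rw [← Real.rpow_one (ε / 8)]
      exact Real.rpow_le_rpow_of_exponent_ge (by positivity) (by linarith) hα1.le
    have h7 : ε / 8 * N ≤ 1 + d x := by linarith [hd x hx]
    have h8 : (N : ℝ) ^ (1 - α) / N = 1 / (N : ℝ) ^ α := by
      rw [Real.rpow_sub hN0, Real.rpow_one]
      have := (Real.rpow_pos_of_pos hN0 α).ne'
      field_simp
    rw [h8]
    calc _ ≤ 1 / (ε / 8 * N) ^ α := by gcongr
      _ = 1 / ((ε / 8) ^ α * (N : ℝ) ^ α) := by rw [Real.mul_rpow (by positivity) hN0.le]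
      _ ≤ 1 / (ε / 8 * (N : ℝ) ^ α) := by gcongr
      _ = _ := by field_simp
  have hsum := Finset.sum_le_card_nsmul _ _ _ hterm
  rw [nsmul_eq_mul, hcard] at hsum
  refine hsum.trans ?_
  have e : 2 * (N : ℝ) * (8 / ε * ((N : ℝ) ^ (1 - α) / N)) = 16 / ε * (N : ℝ) ^ (1 - α) := by
    field_simp; norm_num
  rw [e]
  gcongr ?_ * _
  rw [div_le_div_iff₀ hε0 (by positivity)]
  nlinarith

/-- The gap bounds when the valley is transversal to the rows. -/
lemma metroGap2_valley_bounds {α ε : ℝ} (hα0 : 0 < α) (hα1 : α < 1) (hε0 : 0 < ε)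
    (hε1 : ε ≤ 1) (a b κ : ℝ) (N : ℕ) (hab : a ^ 2 + b ^ 2 = 1) (hba : |b| ≤ |a|) (hN : 1 ≤ N)
    (hκ : ε ≤ κ) (hκ' : κ ≤ 1 / ε) (F : ℤ × ℤ → ℝ)
    (hFdef : ∀ k, F k = (1 + κ * |a * ((k.1 : ℝ) - 1 / 2) + b * ((k.2 : ℝ) - 1 / 2)|) ^ α) :
    1 / (128 * (3 / ε) * (176 / (ε * (1 - α)))) / (N : ℝ) ^ 2 ≤
        metroGap2 (Finset.Icc (-(N : ℤ) + 1) N ×ˢ Finset.Icc (-(N : ℤ) + 1) N) F ∧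
      metroGap2 (Finset.Icc (-(N : ℤ) + 1) N ×ˢ Finset.Icc (-(N : ℤ) + 1) N) F ≤
        (3 / ε) * (176 / (ε * (1 - α))) / (N : ℝ) ^ 2 := by
  have h1 : 0 < 1 - α := by linarith
  have hN0 : (0 : ℝ) < N := by exact_mod_cast hN
  have hN1 : (1 : ℝ) ≤ N := by exact_mod_cast hN
  have hκ0 : 0 < κ := hε0.trans_le hκ
  have ha1 : |a| ≤ 1 := by rw [abs_le_one_iff_mul_self_le_one]; nlinarith
  have hb1 : |b| ≤ 1 := hba.trans ha1
  have ha2 : 1 / 2 ≤ |a| := by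
    have h2 : b ^ 2 ≤ a ^ 2 := sq_le_sq.2 hba
    by_contra! h
    nlinarith [sq_abs a, abs_nonneg a]
  have hhalf : ∀ x ∈ Finset.Icc (-(N : ℤ) + 1) N, |(x : ℝ) - 1 / 2| ≤ N := by
    intro x hx
    rw [Finset.mem_Icc] at hx
    have h2 : -(N : ℝ) + 1 ≤ x := by exact_mod_cast hx.1
    have h3 : (x : ℝ) ≤ N := by exact_mod_cast hx.2
    rw [abs_le]
    constructor <;> linarith
  have hmul : ∀ c : ℝ, |c| ≤ 1 → ∀ x ∈ Finset.Icc (-(N : ℤ) + 1) N,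
      |c * ((x : ℝ) - 1 / 2)| ≤ N := by
    intro c hc x hx
    rw [abs_mul]
    nlinarith [hhalf x hx, abs_nonneg ((x : ℝ) - 1 / 2)]
  have hF : ∀ k, 0 < F k := fun k => by rw [hFdef]; positivity
  have hB : ∀ k ∈ Finset.Icc (-(N : ℤ) + 1) N ×ˢ Finset.Icc (-(N : ℤ) + 1) N,
      F k ≤ 3 / ε * (N : ℝ) ^ α := by
    intro k hk
    rw [Finset.mem_product] at hk
    rw [hFdef]
    have h2 : |a * ((k.1 : ℝ) - 1 / 2) + b * ((k.2 : ℝ) - 1 / 2)| ≤ 2 * N :=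
      (abs_add_le _ _).trans (by linarith [hmul a ha1 _ hk.1, hmul b hb1 _ hk.2])
    have h3 : 1 ≤ 1 / ε := by rw [le_div_iff₀ hε0]; linarith
    have h4 : 1 + κ * |a * ((k.1 : ℝ) - 1 / 2) + b * ((k.2 : ℝ) - 1 / 2)| ≤ 3 / ε * N := by
      have h5 : κ * |a * ((k.1 : ℝ) - 1 / 2) + b * ((k.2 : ℝ) - 1 / 2)| ≤ 1 / ε * (2 * N) := by
        gcongr
      have h6 : 3 / ε * N = 1 / ε * (2 * N) + 1 / ε * N := by ring
      nlinarith
    calc _ ≤ (3 / ε * N) ^ α := by gcongr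
      _ = (3 / ε) ^ α * (N : ℝ) ^ α := Real.mul_rpow (by positivity) hN0.le
      _ ≤ _ := by
        gcongr
        conv_rhs => rw [← Real.rpow_one (3 / ε)]
        refine Real.rpow_le_rpow_of_exponent_le ?_ hα1.le
        rw [le_div_iff₀ hε0]
        linarith
  have hrow : ∀ y ∈ Finset.Icc (-(N : ℤ) + 1) N, ∑ x ∈ Finset.Icc (-(N : ℤ) + 1) N,
      1 / F (x, y) ≤ 176 / (ε * (1 - α)) * (N : ℝ) ^ (1 - α) := by
    intro y hy
    simp only [hFdef]
    exact sum_one_div_rpow_le hα0 hα1 hε0 hε1 N hN κ a (b * ((y : ℝ) - 1 / 2)) hκ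
      (by linarith) (hmul b hb1 y hy)
  have hG : Finset.Icc ((N : ℤ) / 2 + 1) N ⊆ Finset.Icc (-(N : ℤ) + 1) N := by
    intro x hx
    rw [Finset.mem_Icc] at hx ⊢
    omega
  have hcol : ∀ z ∈ Finset.Icc ((N : ℤ) / 2 + 1) N, ∑ y ∈ Finset.Icc (-(N : ℤ) + 1) N,
      1 / F (z, y) ≤ 176 / (ε * (1 - α)) * (N : ℝ) ^ (1 - α) := by
    intro z hz
    simp only [hFdef]
    rcases le_or_gt (1 / 8) |b| with hb | hb
    · simp only [add_comm (a * _)]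
      exact sum_one_div_rpow_le hα0 hα1 hε0 hε1 N hN κ b (a * ((z : ℝ) - 1 / 2)) hκ
        hb (hmul a ha1 z (hG hz))
    · refine sum_one_div_rpow_le_of_far hα0 hα1 hε0 hε1 N hN _ fun y hy => ?_
      have h2 : (N : ℝ) / 2 ≤ z - 1 / 2 := by
        rw [Finset.mem_Icc] at hz
        have h3 : (N : ℤ) + 1 ≤ 2 * z := by omega
        have h4 : (N : ℝ) + 1 ≤ 2 * z := by exact_mod_cast h3
        linarith
      have h5 : (N : ℝ) / 4 ≤ |a * ((z : ℝ) - 1 / 2)| := by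
        rw [abs_mul, abs_of_nonneg (a := (z : ℝ) - 1 / 2) (by linarith)]
        nlinarith
      have h6 : |b * ((y : ℝ) - 1 / 2)| ≤ N / 8 := by
        rw [abs_mul]
        nlinarith [hhalf y hy, abs_nonneg ((y : ℝ) - 1 / 2)]
      have h7 : (N : ℝ) / 8 ≤ |a * ((z : ℝ) - 1 / 2) + b * ((y : ℝ) - 1 / 2)| := by
        have h8 := abs_sub_abs_le_abs_sub (a * ((z : ℝ) - 1 / 2)) (-(b * ((y : ℝ) - 1 / 2)))
        rw [abs_neg, sub_neg_eq_add] at h8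
        linarith
      calc ε * N / 8 = ε * (N / 8) := by ring
        _ ≤ _ := by gcongr
  have hGcard : (N : ℝ) ≤ 2 * (Finset.Icc ((N : ℤ) / 2 + 1) N).card := by
    have : N ≤ 2 * (Finset.Icc ((N : ℤ) / 2 + 1) N).card := by
      rw [Int.card_Icc]
      omega
    exact_mod_cast this
  have hpow : (N : ℝ) ^ α * (N : ℝ) ^ (1 - α) = N := by
    rw [← Real.rpow_add hN0]; simp
  obtain ⟨hl, hu⟩ := metroGap2_bounds N hN F hF _ _ _ hG hGcard hB hrow hcol
  constructor
  · refine le_trans (le_of_eq ?_) hl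
    rw [div_div]
    congr 1
    calc _ = 128 * (3 / ε) * (176 / (ε * (1 - α))) * N * N := by ring
      _ = 128 * (3 / ε) * (176 / (ε * (1 - α))) * N * ((N : ℝ) ^ α * (N : ℝ) ^ (1 - α)) := by
        rw [hpow]
      _ = _ := by ring
  · refine hu.trans (le_of_eq ?_)
    rw [div_eq_div_iff (by positivity) (by positivity)]
    calc _ = (3 / ε) * (176 / (ε * (1 - α))) * ((N : ℝ) ^ α * (N : ℝ) ^ (1 - α)) * N ^ 2 := by ring
      _ = _ := by rw [hpow]; ring

/-- valley effect, `α < 1`: for the target proportional to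
`(1 + A·d((x₁-1/2)/N,(x₂-1/2)/N), L))^α` with `L = {a·z₁+b·z₂=0}`,
`a²+b²=1`, and `εA ≤ N ≤ A/ε`, the spectral gap on `{-N+1,…,N}²` is of order
`1/N²`. -/
theorem gap_valley_subcritical (α : ℝ) (hα0 : 0 < α) (hα1 : α < 1)
    (ε : ℝ) (hε0 : 0 < ε) (hε1 : ε ≤ 1) :
    ∃ c C : ℝ, 0 < c ∧ 0 < C ∧
    ∀ (a b A : ℝ) (N : ℤ), a ^ 2 + b ^ 2 = 1 → 0 < A → 1 ≤ N →
      ε * A ≤ (N : ℝ) → (N : ℝ) ≤ A / ε →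
      c / (N : ℝ) ^ 2 ≤
        metroGap2 (Finset.Icc (-N + 1) N ×ˢ Finset.Icc (-N + 1) N)
          (fun k => (1 + A * |a * ((k.1 : ℝ) - 1 / 2) / (N : ℝ) +
            b * ((k.2 : ℝ) - 1 / 2) / (N : ℝ)|) ^ α) ∧
      metroGap2 (Finset.Icc (-N + 1) N ×ˢ Finset.Icc (-N + 1) N)
          (fun k => (1 + A * |a * ((k.1 : ℝ) - 1 / 2) / (N : ℝ) +
            b * ((k.2 : ℝ) - 1 / 2) / (N : ℝ)|) ^ α) ≤ C / (N : ℝ) ^ 2 := by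
  have h1 : 0 < 1 - α := by linarith
  refine ⟨1 / (128 * (3 / ε) * (176 / (ε * (1 - α)))), (3 / ε) * (176 / (ε * (1 - α))),
    by positivity, by positivity, ?_⟩
  intro a b A N hab hA hN hAN hNA
  lift N to ℕ using (by omega) with n
  have hn : 1 ≤ n := by exact_mod_cast hN
  have hn0 : (0 : ℝ) < n := by exact_mod_cast hn
  simp only [Int.cast_natCast] at *
  have hκ : ε ≤ A / n := by
    rw [le_div_iff₀ hε0] at hNA
    rw [le_div_iff₀ hn0]
    linarith
  have hκ' : A / n ≤ 1 / ε := by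
    rw [div_le_div_iff₀ hn0 hε0]
    linarith
  have hform : ∀ x y : ℝ, A * |a * x / n + b * y / n| = A / n * |a * x + b * y| := by
    intro x y
    rw [← add_div, abs_div, abs_of_pos hn0]
    ring
  rcases le_total |b| |a| with hba | hba
  · exact metroGap2_valley_bounds hα0 hα1 hε0 hε1 a b (A / n) n hab hba hn hκ hκ' _
      fun k => by rw [hform]
  · rw [← metroGap2_swap]
    refine metroGap2_valley_bounds hα0 hα1 hε0 hε1 b a (A / n) n (by linarith) hba hn hκ hκ' _
      fun k => ?_
    rw [hform, add_comm (a * _)]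
    rfl
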